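/- arXiv:2201.05084 — 2 statements merged into one kernel-verified Lean document; each statement's English description precedes it below -/
import Mathlib

section
/- For all real t > 0, log G(1+t) − t log Γ(t) = ζ'(−1) − ζ'(−1, t), where G is the Barnes double gamma function, ζ'(−1,t) is the s-derivative of the Hurwitz zeta function at s = −1, and ζ'(−1) = ζ'(−1,1) is the derivative of the Riemann zeta function at −1. -/
open Real Complex Filter Topology

/-- `log G(1+x)` for the Barnes double gamma function `G`, given for `x > -1` by the
convergent expansion
`log G(1+x) = (x/2) log(2π) - x(1+x)/2 - γx²/2 + ∑ₙ [x²/(2n) - x + n log(1 + x/n)]`. -/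
noncomputable def logBarnesG1p (x : ℝ) : ℝ :=
  x / 2 * Real.log (2 * π) - x * (1 + x) / 2
    - Real.eulerMascheroniConstant * x ^ 2 / 2
    + ∑' n : ℕ, (x ^ 2 / (2 * (n + 1)) - x + (n + 1) * Real.log (1 + x / (n + 1)))

/-- If the third derivative of `f₁` is bounded by `C` on `[0, 1]`, the trapezoidal rule for
`f₁` with its first Euler–Maclaurin correction has error at most `2 * C`. -/
lemma norm_corrected_trapezoid_error_le {F f₁ f₂ f₃ f₄ : ℝ → ℂ} {C : ℝ}
    (hF : ∀ x ∈ Set.Icc (0 : ℝ) 1, HasDerivAt F (f₁ x) x)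
    (h₁ : ∀ x ∈ Set.Icc (0 : ℝ) 1, HasDerivAt f₁ (f₂ x) x)
    (h₂ : ∀ x ∈ Set.Icc (0 : ℝ) 1, HasDerivAt f₂ (f₃ x) x)
    (h₃ : ∀ x ∈ Set.Icc (0 : ℝ) 1, HasDerivAt f₃ (f₄ x) x)
    (hC : ∀ x ∈ Set.Icc (0 : ℝ) 1, ‖f₄ x‖ ≤ C) :
    ‖(f₁ 0 + f₁ 1) / 2 - (F 1 - F 0) - (f₂ 1 - f₂ 0) / 12‖ ≤ 2 * C := by
  have step : ∀ {g g' : ℝ → ℂ}, g 0 = 0 →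
      (∀ x ∈ Set.Icc (0 : ℝ) 1, HasDerivAt g (g' x) x) →
      (∀ x ∈ Set.Icc (0 : ℝ) 1, ‖g' x‖ ≤ C) → ∀ x ∈ Set.Icc (0 : ℝ) 1, ‖g x‖ ≤ C := by
    intro g g' hg0 hg hb x hx
    have hC0 : 0 ≤ C := (norm_nonneg _).trans (hb 0 (by simp))
    have := norm_image_sub_le_of_norm_deriv_le_segment' (a := 0) (b := 1)
      (fun y hy => (hg y hy).hasDerivWithinAt) (fun y hy => hb y ⟨hy.1, hy.2.le⟩) x hx
    rw [hg0, sub_zero, sub_zero] at this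
    exact this.trans (mul_le_of_le_one_right hC0 hx.2)
  have hid : ∀ x : ℝ, HasDerivAt (fun y : ℝ => (y : ℂ)) 1 x := fun x => by
    simpa using (hasDerivAt_id x).ofReal_comp
  have r₃ := step (g := fun x => f₃ x - f₃ 0) (by simp) (fun x hx => (h₃ x hx).sub_const _) hC
  have r₂ := step (g := fun x => f₂ x - f₂ 0 - x * f₃ 0) (by simp)
    (fun x hx => by
      convert! ((h₂ x hx).sub_const (f₂ 0)).sub ((hid x).mul_const (f₃ 0)) using 1
      ring) r₃
  have r₁ := step (g := fun x => f₁ x - f₁ 0 - x * f₂ 0 - x ^ 2 / 2 * f₃ 0) (by simp)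
    (fun x hx => by
      convert! (((h₁ x hx).sub_const (f₁ 0)).sub ((hid x).mul_const (f₂ 0))).sub
        ((((hid x).pow 2).div_const 2).mul_const (f₃ 0)) using 1
      push_cast
      ring) r₂
  have r₀ := step (g := fun x => F x - F 0 - x * f₁ 0 - x ^ 2 / 2 * f₂ 0 - x ^ 3 / 6 * f₃ 0)
    (by simp)
    (fun x hx => by
      convert! ((((hF x hx).sub_const (F 0)).sub ((hid x).mul_const (f₁ 0))).sub
        ((((hid x).pow 2).div_const 2).mul_const (f₂ 0))).sub
        ((((hid x).pow 3).div_const 6).mul_const (f₃ 0)) using 1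
      push_cast
      ring) r₁
  have m : (1 : ℝ) ∈ Set.Icc (0 : ℝ) 1 := by simp
  have e : (f₁ 0 + f₁ 1) / 2 - (F 1 - F 0) - (f₂ 1 - f₂ 0) / 12
      = (1 / 2 : ℂ) * (f₁ 1 - f₁ 0 - (1 : ℝ) * f₂ 0 - (1 : ℝ) ^ 2 / 2 * f₃ 0)
        - (F 1 - F 0 - (1 : ℝ) * f₁ 0 - (1 : ℝ) ^ 2 / 2 * f₂ 0 - (1 : ℝ) ^ 3 / 6 * f₃ 0)
        - (1 / 12 : ℂ) * (f₂ 1 - f₂ 0 - (1 : ℝ) * f₃ 0) := by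
    push_cast
    ring
  rw [e]
  refine (norm_sub_le _ _).trans ((add_le_add_left (norm_sub_le _ _) _).trans ?_)
  rw [norm_mul, norm_mul]
  have a := r₁ 1 m
  have b := r₀ 1 m
  have c := r₂ 1 m
  have n₁ : ‖(1 / 2 : ℂ)‖ = 1 / 2 := by norm_num
  have n₂ : ‖(1 / 12 : ℂ)‖ = 1 / 12 := by norm_num
  have hC0 : 0 ≤ C := (norm_nonneg _).trans a
  rw [n₁, n₂]
  linarith

/-- The leading Euler–Maclaurin terms of the Hurwitz zeta tail `∑ n, (n + u) ^ (-s)`. -/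
noncomputable def hurwitzTail (u : ℝ) (s : ℂ) : ℂ :=
  (u : ℂ) ^ (1 - s) / (s - 1) + (u : ℂ) ^ (-s) / 2 + s * (u : ℂ) ^ (-s - 1) / 12

/-- The error made by `hurwitzTail` over one unit step. -/
noncomputable def hurwitzTerm (u : ℝ) (s : ℂ) : ℂ :=
  (u : ℂ) ^ (-s) - hurwitzTail u s + hurwitzTail (u + 1) s

lemma hasDerivAt_const_add_cpow {u x : ℝ} (h : 0 < u + x) (c : ℂ) :
    HasDerivAt (fun y : ℝ => ((u + y : ℝ) : ℂ) ^ c) (c * ((u + x : ℝ) : ℂ) ^ (c - 1)) x := by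
  have h₁ : HasDerivAt (fun y : ℝ => ((u + y : ℝ) : ℂ)) 1 x := by
    simpa using ((hasDerivAt_id x).const_add u).ofReal_comp
  have h₂ := (hasDerivAt_id ((u + x : ℝ) : ℂ)).cpow_const (c := c)
    (Complex.ofReal_mem_slitPlane.2 h)
  convert! HasDerivAt.comp_of_eq (𝕜' := ℂ) x h₂ h₁ rfl using 1
  simp

lemma norm_hurwitzTerm_le {u : ℝ} (hu : 0 < u) {s : ℂ} (hs1 : s ≠ 1) (hs : -3 ≤ s.re) :
    ‖hurwitzTerm u s‖ ≤ 2 * (‖s‖ * ‖s + 1‖ * ‖s + 2‖ * u ^ (-s.re - 3)) := by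
  have hpos : ∀ x ∈ Set.Icc (0 : ℝ) 1, 0 < u + x := fun x hx => by linarith [hx.1]
  have h1s : (1 - s) ≠ 0 := sub_ne_zero.2 hs1.symm
  have h1s' : (s - 1) ≠ 0 := sub_ne_zero.2 hs1
  have key := norm_corrected_trapezoid_error_le (C := ‖s‖ * ‖s + 1‖ * ‖s + 2‖ * u ^ (-s.re - 3))
    (F := fun x => ((u + x : ℝ) : ℂ) ^ (1 - s) / (1 - s))
    (f₁ := fun x => ((u + x : ℝ) : ℂ) ^ (-s))
    (f₂ := fun x => -s * ((u + x : ℝ) : ℂ) ^ (-s - 1))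
    (f₃ := fun x => -s * ((-s - 1) * ((u + x : ℝ) : ℂ) ^ (-s - 2)))
    (f₄ := fun x => -s * ((-s - 1) * ((-s - 2) * ((u + x : ℝ) : ℂ) ^ (-s - 3))))
    (fun x hx => by
      convert! (hasDerivAt_const_add_cpow (hpos x hx) (1 - s)).div_const (1 - s) using 1
      rw [mul_div_cancel_left₀ _ h1s]
      ring_nf)
    (fun x hx => hasDerivAt_const_add_cpow (hpos x hx) (-s))
    (fun x hx => by
      convert! (hasDerivAt_const_add_cpow (hpos x hx) (-s - 1)).const_mul (-s) using 4
      ring)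
    (fun x hx => by
      convert! ((hasDerivAt_const_add_cpow (hpos x hx) (-s - 2)).const_mul (-s - 1)).const_mul (-s)
        using 5
      ring)
    (fun x hx => by
      rw [norm_mul, norm_mul, norm_mul, Complex.norm_cpow_eq_rpow_re_of_pos (hpos x hx), norm_neg,
        show -s - 1 = -(s + 1) by ring, show -s - 2 = -(s + 2) by ring, norm_neg, norm_neg,
        ← mul_assoc, ← mul_assoc]
      have : (-s - 3).re = -s.re - 3 := by simp
      rw [this]
      exact mul_le_mul_of_nonneg_left (Real.rpow_le_rpow_of_nonpos hu
        (le_add_of_nonneg_right hx.1) (by linarith)) (by positivity))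
  refine le_of_eq_of_le (congrArg _ ?_) key
  simp only [hurwitzTerm, hurwitzTail, add_zero]
  rw [show (1 - s) = -(s - 1) by ring]
  field_simp
  ring

lemma differentiableAt_hurwitzTail {u : ℝ} (hu : 0 < u) {s : ℂ} (hs : s ≠ 1) :
    DifferentiableAt ℂ (hurwitzTail u) s := by
  have h0 : (u : ℂ) ≠ 0 := Complex.ofReal_ne_zero.2 hu.ne'
  have h1 : s - 1 ≠ 0 := sub_ne_zero.2 hs
  have hc : ∀ f : ℂ → ℂ, DifferentiableAt ℂ f s →
      DifferentiableAt ℂ (fun z => (u : ℂ) ^ f z) s := fun f hf => hf.const_cpow (Or.inl h0)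
  unfold hurwitzTail
  exact (((hc _ (by fun_prop)).div (by fun_prop) h1).add ((hc _ (by fun_prop)).div_const 2)).add
    ((differentiableAt_id.mul (hc _ (by fun_prop))).div_const 12)

lemma hasDerivAt_cpow_neg_neg_one {u : ℝ} (hu : 0 < u) :
    HasDerivAt (fun s : ℂ => (u : ℂ) ^ (-s)) ((-(u * Real.log u) : ℝ) : ℂ) (-1) := by
  have h0 : (u : ℂ) ≠ 0 := Complex.ofReal_ne_zero.2 hu.ne'
  convert! (hasDerivAt_neg (-1 : ℂ)).const_cpow (c := (u : ℂ)) (Or.inl h0) using 1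
  push_cast [Complex.ofReal_log hu.le]
  simp

lemma hasDerivAt_hurwitzTail_neg_one {u : ℝ} (hu : 0 < u) :
    HasDerivAt (hurwitzTail u)
      (((u ^ 2 / 2 - u / 2 + 1 / 12) * Real.log u - u ^ 2 / 4 + 1 / 12 : ℝ) : ℂ) (-1) := by
  have h0 : (u : ℂ) ≠ 0 := Complex.ofReal_ne_zero.2 hu.ne'
  have a := (((hasDerivAt_id (-1 : ℂ)).const_sub 1).const_cpow (c := (u : ℂ)) (Or.inl h0)).div
    ((hasDerivAt_id (-1 : ℂ)).sub_const 1) (by norm_num)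
  have b := (hasDerivAt_cpow_neg_neg_one hu).div_const 2
  have c := ((hasDerivAt_id (-1 : ℂ)).mul
    (((hasDerivAt_neg (-1 : ℂ)).sub_const 1).const_cpow (c := (u : ℂ)) (Or.inl h0))).div_const 12
  convert! (a.add b).add c using 1
  have h2 : (u : ℂ) ^ ((1 : ℂ) - id (-1)) = u ^ 2 := by
    rw [← Complex.cpow_natCast]; norm_num
  have h3 : (u : ℂ) ^ (-(-1) - 1 : ℂ) = 1 := by norm_num
  rw [h2, h3]
  push_cast [Complex.ofReal_log hu.le]
  simp only [id]
  ring

lemma summable_nat_add_rpow {t p : ℝ} (ht : 0 < t) (hp : p < -1) :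
    Summable fun n : ℕ => ((n : ℝ) + t) ^ p := by
  refine ((Real.summable_one_div_nat_add_rpow t (-p)).2 (by linarith)).congr fun n => ?_
  have : 0 < (n : ℝ) + t := by positivity
  rw [abs_of_pos this, Real.rpow_neg this.le, one_div, inv_inv]

lemma sum_range_hurwitzTerm (t : ℝ) (s : ℂ) (N : ℕ) :
    ∑ n ∈ Finset.range N, hurwitzTerm (n + t) s
      = ∑ n ∈ Finset.range N, (((n : ℝ) + t : ℝ) : ℂ) ^ (-s)
        - hurwitzTail t s + hurwitzTail (N + t) s := by
  induction N with
  | zero => simp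
  | succ k ih =>
    rw [Finset.sum_range_succ, ih, Finset.sum_range_succ, hurwitzTerm]
    push_cast
    rw [show (k : ℝ) + 1 + t = k + t + 1 by ring]
    ring

lemma tendsto_ofReal_cpow_zero {c : ℂ} (hc : c.re < 0) :
    Tendsto (fun u : ℝ => (u : ℂ) ^ c) atTop (𝓝 0) := by
  rw [tendsto_zero_iff_norm_tendsto_zero]
  have := tendsto_rpow_neg_atTop (y := -c.re) (by linarith)
  rw [neg_neg] at this
  refine this.congr' ?_
  filter_upwards [eventually_gt_atTop 0] with u hu
  rw [Complex.norm_cpow_eq_rpow_re_of_pos hu]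

lemma tendsto_hurwitzTail_zero {s : ℂ} (hs : 1 < s.re) :
    Tendsto (fun u : ℝ => hurwitzTail u s) atTop (𝓝 0) := by
  have a := (tendsto_ofReal_cpow_zero (c := 1 - s) (by simpa using hs)).div_const (s - 1)
  have b := (tendsto_ofReal_cpow_zero (c := -s) (by simp; linarith)).div_const 2
  have c := ((tendsto_ofReal_cpow_zero (c := -s - 1) (by simp; linarith)).const_mul s).div_const 12
  simpa [hurwitzTail] using (a.add b).add c

lemma tsum_hurwitzTerm {t : ℝ} (ht : 0 < t) {s : ℂ} (hs : 1 < s.re) :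
    ∑' n : ℕ, hurwitzTerm (n + t) s
      = ∑' n : ℕ, ((n : ℂ) + (t : ℂ)) ^ (-s) - hurwitzTail t s := by
  have hs1 : s ≠ 1 := fun h => by simp [h] at hs
  have hpos : ∀ n : ℕ, 0 < (n : ℝ) + t := fun n => by positivity
  have hterm : Summable fun n : ℕ => hurwitzTerm (n + t) s :=
    Summable.of_norm_bounded
      (((summable_nat_add_rpow ht (by linarith)).mul_left (‖s‖ * ‖s + 1‖ * ‖s + 2‖)).mul_left 2)
      fun n => norm_hurwitzTerm_le (hpos n) hs1 (by linarith)
  have hseries : Summable fun n : ℕ => ((n : ℂ) + (t : ℂ)) ^ (-s) := by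
    refine Summable.of_norm_bounded (summable_nat_add_rpow ht (p := -s.re) (by linarith))
      fun n => le_of_eq ?_
    have := Complex.norm_cpow_eq_rpow_re_of_pos (hpos n) (-s)
    push_cast at this
    simpa using this
  have hlim : Tendsto (fun N : ℕ => hurwitzTail (N + t) s) atTop (𝓝 0) :=
    (tendsto_hurwitzTail_zero hs).comp
      (tendsto_atTop_add_const_right _ t tendsto_natCast_atTop_atTop)
  refine tendsto_nhds_unique hterm.hasSum.tendsto_sum_nat ?_
  have := (hseries.hasSum.tendsto_sum_nat.sub_const (hurwitzTail t s)).add hlim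
  rw [add_zero] at this
  refine this.congr fun N => ?_
  rw [sum_range_hurwitzTerm]
  push_cast
  rfl

/-- A convex open set containing `-1` and points of real part greater than `1`, but not the
pole `1`. -/
def hurwitzRegion : Set ℂ :=
  {s | -1 < s.im - s.re} ∩ {s | -(3 / 2) < s.re} ∩ Metric.ball 0 4

lemma isOpen_hurwitzRegion : IsOpen hurwitzRegion :=
  ((isOpen_lt continuous_const (Complex.continuous_im.sub Complex.continuous_re)).inter
    (isOpen_lt continuous_const Complex.continuous_re)).inter Metric.isOpen_ball

lemma isPreconnected_hurwitzRegion : IsPreconnected hurwitzRegion := by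
  refine Convex.isPreconnected (((?_ : Convex ℝ _).inter ?_).inter (convex_ball _ _))
  · exact convex_halfSpace_gt (Complex.imLm - Complex.reLm).isLinear _
  · exact convex_halfSpace_re_gt _

lemma ne_one_of_mem_hurwitzRegion {s : ℂ} (hs : s ∈ hurwitzRegion) : s ≠ 1 := by
  rintro rfl
  simpa using hs.1.1

lemma norm_hurwitzTerm_le_of_mem_hurwitzRegion {u : ℝ} (hu : 0 < u) {s : ℂ}
    (hs : s ∈ hurwitzRegion) :
    ‖hurwitzTerm u s‖ ≤ 240 * (u ^ (-(3 / 2) : ℝ) + u ^ (-7 : ℝ)) := by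
  have hre : -(3 / 2) < s.re := hs.1.2
  have hn : ‖s‖ ≤ 4 := by simpa using (mem_ball_zero_iff.1 hs.2).le
  have hre4 : s.re ≤ 4 := (Complex.re_le_norm s).trans hn
  have h1 : ‖s + 1‖ ≤ 5 := (norm_add_le _ _).trans (by norm_num; linarith)
  have h2 : ‖s + 2‖ ≤ 6 := (norm_add_le _ _).trans (by norm_num; linarith)
  have hpow : u ^ (-s.re - 3) ≤ u ^ (-(3 / 2) : ℝ) + u ^ (-7 : ℝ) := by
    rcases le_total 1 u with h | h
    · have := Real.rpow_le_rpow_of_exponent_le h (show -s.re - 3 ≤ -(3 / 2) by linarith)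
      have := Real.rpow_nonneg hu.le (-7)
      linarith
    · have := Real.rpow_le_rpow_of_exponent_ge hu h (show -7 ≤ -s.re - 3 by linarith)
      have := Real.rpow_nonneg hu.le (-(3 / 2))
      linarith
  calc ‖hurwitzTerm u s‖
      ≤ 2 * (‖s‖ * ‖s + 1‖ * ‖s + 2‖ * u ^ (-s.re - 3)) :=
        norm_hurwitzTerm_le hu (ne_one_of_mem_hurwitzRegion hs) (by linarith)
    _ ≤ 2 * (4 * 5 * 6 * (u ^ (-(3 / 2) : ℝ) + u ^ (-7 : ℝ))) := by gcongr
    _ = _ := by ring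

/-- The derivative at `-1` of a continuation of the Hurwitz zeta function, as a limit of
elementary expressions. -/
lemma tendsto_deriv_neg_one_of_hurwitz_continuation {Z : ℂ → ℂ} {t : ℝ} (ht : 0 < t)
    (hdiff : ∀ s : ℂ, s ≠ 1 → DifferentiableAt ℂ Z s)
    (hser : ∀ s : ℂ, 1 < s.re → Z s = ∑' n : ℕ, ((n : ℂ) + (t : ℂ)) ^ (-s)) :
    Tendsto (fun N : ℕ => ((-∑ n ∈ Finset.range N, ((n : ℝ) + t) * Real.log (n + t)
      + (((N + t) ^ 2 / 2 - (N + t) / 2 + 1 / 12) * Real.log (N + t) - (N + t) ^ 2 / 4 + 1 / 12)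
        : ℝ) : ℂ)) atTop (𝓝 (deriv Z (-1))) := by
  have hpos : ∀ n : ℕ, 0 < (n : ℝ) + t := fun n => by positivity
  have hu := ((summable_nat_add_rpow ht (p := -(3 / 2)) (by norm_num)).add
    (summable_nat_add_rpow ht (p := -7) (by norm_num))).mul_left 240
  have hterm : ∀ n : ℕ, DifferentiableOn ℂ (hurwitzTerm (n + t)) hurwitzRegion := by
    intro n s hs
    have hs1 := ne_one_of_mem_hurwitzRegion hs
    have h0 : (((n : ℝ) + t : ℝ) : ℂ) ≠ 0 := Complex.ofReal_ne_zero.2 (hpos n).ne'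
    exact ((((differentiableAt_id.neg).const_cpow (Or.inl h0)).sub
      (differentiableAt_hurwitzTail (hpos n) hs1)).add
      (differentiableAt_hurwitzTail (by linarith [hpos n]) hs1)).differentiableWithinAt
  have hbound : ∀ (n : ℕ) (w : ℂ), w ∈ hurwitzRegion → ‖hurwitzTerm (n + t) w‖ ≤ _ :=
    fun n w hw => norm_hurwitzTerm_le_of_mem_hurwitzRegion (hpos n) hw
  have hmem : (-1 : ℂ) ∈ hurwitzRegion := by
    refine ⟨⟨?_, ?_⟩, ?_⟩ <;> norm_num
  have hS := differentiableOn_tsum_of_summable_norm hu hterm isOpen_hurwitzRegion hbound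
  have hderiv :=
    (hasSum_deriv_of_summable_norm hu hterm isOpen_hurwitzRegion hbound hmem).tendsto_sum_nat
  have hT : DifferentiableOn ℂ (hurwitzTail t) hurwitzRegion := fun s hs =>
    (differentiableAt_hurwitzTail ht (ne_one_of_mem_hurwitzRegion hs)).differentiableWithinAt
  have hZ : DifferentiableOn ℂ Z hurwitzRegion := fun s hs =>
    (hdiff s (ne_one_of_mem_hurwitzRegion hs)).differentiableWithinAt
  have hbase : (2 + 2 * I : ℂ) ∈ hurwitzRegion := by
    refine ⟨⟨?_, ?_⟩, ?_⟩
    · norm_num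
    · norm_num
    · rw [mem_ball_zero_iff, Complex.norm_def, Real.sqrt_lt' (by norm_num)]
      norm_num [Complex.normSq_apply]
  have heq : Set.EqOn Z
      ((fun s => ∑' n : ℕ, hurwitzTerm (n + t) s) + hurwitzTail t) hurwitzRegion := by
    refine (hZ.analyticOnNhd isOpen_hurwitzRegion).eqOn_of_preconnected_of_eventuallyEq
      ((hS.add hT).analyticOnNhd isOpen_hurwitzRegion) isPreconnected_hurwitzRegion hbase ?_
    have : {s : ℂ | 1 < s.re} ∈ 𝓝 (2 + 2 * I : ℂ) :=
      (isOpen_lt continuous_const Complex.continuous_re).mem_nhds (by norm_num)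
    filter_upwards [this] with s hs
    simp [hser s hs, tsum_hurwitzTerm ht hs]
  have hnhds := isOpen_hurwitzRegion.mem_nhds hmem
  have hdZ : deriv Z (-1) = deriv (fun s => ∑' n : ℕ, hurwitzTerm (n + t) s) (-1)
      + deriv (hurwitzTail t) (-1) := by
    rw [(heq.eventuallyEq_of_mem hnhds).deriv_eq]
    exact deriv_add (hS.differentiableAt hnhds) (hT.differentiableAt hnhds)
  rw [hdZ]
  refine (hderiv.add_const (deriv (hurwitzTail t) (-1))).congr fun N => ?_
  have hsum : deriv (fun s => ∑ n ∈ Finset.range N, hurwitzTerm (n + t) s) (-1)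
      = ∑ n ∈ Finset.range N, deriv (hurwitzTerm (n + t)) (-1) :=
    deriv_fun_sum fun n _ => (hterm n).differentiableAt hnhds
  rw [← hsum, funext fun s => sum_range_hurwitzTerm t s N]
  have hd := ((HasDerivAt.fun_sum fun n (_ : n ∈ Finset.range N) =>
    hasDerivAt_cpow_neg_neg_one (hpos n)).fun_sub (hasDerivAt_hurwitzTail_neg_one ht)).fun_add
    (hasDerivAt_hurwitzTail_neg_one (hpos N))
  rw [(hasDerivAt_hurwitzTail_neg_one ht).deriv, HasDerivAt.deriv hd]
  push_cast
  rw [Finset.sum_neg_distrib]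
  ring

lemma tendsto_sq_mul_log_one_add_div_sub (a : ℝ) :
    Tendsto (fun n : ℕ => (n : ℝ) ^ 2 * Real.log (1 + a / n) - a * n) atTop
      (𝓝 (-(a ^ 2 / 2))) := by
  have h0 : Tendsto (fun n : ℕ => |a / (n : ℝ)|) atTop (𝓝 0) := by
    simpa using (tendsto_const_div_atTop_nhds_zero_nat a).abs
  have hb : Tendsto (fun n : ℕ => a ^ 2 * (|a / (n : ℝ)| / (1 - |a / (n : ℝ)|))) atTop (𝓝 0) := by
    simpa using (h0.div (h0.const_sub 1) (by norm_num)).const_mul (a ^ 2)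
  rw [tendsto_iff_norm_sub_tendsto_zero]
  refine squeeze_zero' (Eventually.of_forall fun _ => norm_nonneg _) ?_ hb
  filter_upwards [eventually_gt_atTop 0, h0.eventually_lt_const one_pos] with n hn hlt
  have hn' : (0 : ℝ) < n := by exact_mod_cast hn
  have key := Real.abs_log_sub_add_sum_range_le (x := -(a / n)) (by rwa [abs_neg]) 2
  rw [abs_neg, sub_neg_eq_add] at key
  norm_num [Finset.sum_range_succ] at key
  have e : (n : ℝ) ^ 2 * Real.log (1 + a / n) - a * n - -(a ^ 2 / 2)
      = n ^ 2 * (-(a / n) + (a / n) ^ 2 / 2 + Real.log (1 + a / n)) := by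
    field_simp
    ring
  rw [e, Real.norm_eq_abs, abs_mul, abs_of_pos (by positivity : (0 : ℝ) < n ^ 2)]
  rw [abs_div, Nat.abs_cast] at hlt key ⊢
  calc (n : ℝ) ^ 2 * |-(a / n) + (a / n) ^ 2 / 2 + Real.log (1 + a / n)|
      ≤ n ^ 2 * ((|a| / n) ^ 3 / (1 - |a| / n)) := by gcongr
    _ = a ^ 2 * (|a| / n / (1 - |a| / n)) := by
      rw [← sq_abs a]
      field_simp

lemma tendsto_log_one_add_div_nat (a : ℝ) :
    Tendsto (fun n : ℕ => Real.log (1 + a / n)) atTop (𝓝 0) := by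
  have h := (tendsto_const_div_atTop_nhds_zero_nat a).const_add 1
  rw [add_zero] at h
  simpa using h.log one_ne_zero

/-- Shifting the Euler–Maclaurin terms of `∑ k log k` by `a`, up to the parts that diverge. -/
lemma tendsto_shifted_eulerMaclaurin (a : ℝ) :
    Tendsto (fun n : ℕ => (((n : ℝ) + a) ^ 2 / 2 - (n + a) / 2 + 1 / 12) * Real.log (1 + a / n)
      - (n + a) ^ 2 / 4 + 1 / 12 + (n : ℝ) ^ 2 / 4) atTop
      (𝓝 (a ^ 2 / 2 - a / 2 + 1 / 12)) := by
  have h₁ := (Real.tendsto_mul_log_one_add_div_atTop a).comp tendsto_natCast_atTop_atTop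
  have := ((((tendsto_sq_mul_log_one_add_div_sub a).const_mul (1 / 2)).add
    (h₁.const_mul (a - 1 / 2))).add
    ((tendsto_log_one_add_div_nat a).const_mul (a ^ 2 / 2 - a / 2 + 1 / 12))).add_const
    (1 / 12 - a ^ 2 / 4)
  convert! this using 1
  · funext n
    simp only [Function.comp_apply]
    ring
  · congr 1
    ring

lemma tendsto_log_factorial_sub :
    Tendsto (fun n : ℕ => Real.log n.factorial
      - (n * Real.log n - n + Real.log n / 2)) atTop (𝓝 (Real.log (2 * π) / 2)) := by
  have h := (Stirling.tendsto_stirlingSeq_sqrt_pi.log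
    (Real.sqrt_ne_zero'.2 Real.pi_pos)).add_const (Real.log 2 / 2)
  have e : Real.log (√π) + Real.log 2 / 2 = Real.log (2 * π) / 2 := by
    rw [Real.log_sqrt Real.pi_pos.le, Real.log_mul two_ne_zero Real.pi_ne_zero]
    ring
  rw [e] at h
  refine h.congr' ?_
  filter_upwards [eventually_ne_atTop 0] with n hn
  have hn' : (n : ℝ) ≠ 0 := Nat.cast_ne_zero.2 hn
  rw [Stirling.log_stirlingSeq_formula, Real.log_mul two_ne_zero hn',
    Real.log_div hn' (Real.exp_ne_zero 1), Real.log_exp]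
  ring

lemma sum_range_barnesG_term {t : ℝ} (ht : 0 < t) (N : ℕ) :
    ∑ n ∈ Finset.range N, (t ^ 2 / (2 * ((n : ℝ) + 1)) - t
        + ((n : ℝ) + 1) * Real.log (1 + t / (n + 1)))
      = t ^ 2 / 2 * (harmonic N : ℝ) - t * N
        + ∑ n ∈ Finset.range (N + 1), ((n : ℝ) + t) * Real.log (n + t)
        - t * ∑ n ∈ Finset.range (N + 1), Real.log (t + n)
        - ∑ n ∈ Finset.range N, ((n : ℝ) + 1) * Real.log (n + 1) := by
  induction N with
  | zero => simp
  | succ k ih =>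
    have hk : (0 : ℝ) < k + 1 := by positivity
    have hlog : Real.log (1 + t / ((k : ℝ) + 1))
        = Real.log (t + (k + 1)) - Real.log ((k : ℝ) + 1) := by
      rw [← Real.log_div (by positivity) hk.ne']
      congr 1
      field_simp
      ring
    rw [Finset.sum_range_succ, ih, hlog, harmonic_succ, Finset.sum_range_succ _ (k + 1),
      Finset.sum_range_succ _ (k + 1),
      Finset.sum_range_succ (fun n : ℕ => ((n : ℝ) + 1) * Real.log (n + 1)) k]
    push_cast
    rw [add_comm ((k : ℝ) + 1) t]
    field_simp
    ring

lemma barnesG_term_nonneg {t : ℝ} (ht : 0 ≤ t) (n : ℕ) :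
    0 ≤ t ^ 2 / (2 * ((n : ℝ) + 1)) - t + ((n : ℝ) + 1) * Real.log (1 + t / (n + 1)) := by
  have hn : (0 : ℝ) < n + 1 := by positivity
  set m : ℝ := n + 1
  have h := Real.le_log_one_add_of_nonneg (x := t / m) (by positivity)
  have hle : t - t ^ 2 / (2 * m) ≤ m * (2 * (t / m) / (t / m + 2)) := by
    have e : m * (2 * (t / m) / (t / m + 2)) - (t - t ^ 2 / (2 * m))
        = t ^ 3 / (2 * m * (t + 2 * m)) := by
      field_simp
      ring
    have : 0 ≤ t ^ 3 / (2 * m * (t + 2 * m)) := by positivity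
    linarith
  have := mul_le_mul_of_nonneg_left h hn.le
  linarith

/-- The elementary expression converging to the difference of zeta derivatives at `-1` agrees,
up to convergent sequences, with the partial sums defining `log G(1+t)`. -/
lemma sum_range_barnesG_term_eq {t : ℝ} (ht : 0 < t) {N : ℕ} (hN : N ≠ 0) :
    ∑ n ∈ Finset.range N, (t ^ 2 / (2 * ((n : ℝ) + 1)) - t
        + ((n : ℝ) + 1) * Real.log (1 + t / (n + 1)))
      = ((-∑ n ∈ Finset.range N, ((n : ℝ) + 1) * Real.log (n + 1)
          + (((N + 1 : ℝ) ^ 2 / 2 - (N + 1) / 2 + 1 / 12) * Real.log (N + 1)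
            - (N + 1) ^ 2 / 4 + 1 / 12))
        - (-∑ n ∈ Finset.range (N + 1), ((n : ℝ) + t) * Real.log (n + t)
          + ((((N + 1 : ℕ) + t) ^ 2 / 2 - ((N + 1 : ℕ) + t) / 2 + 1 / 12)
            * Real.log ((N + 1 : ℕ) + t) - ((N + 1 : ℕ) + t) ^ 2 / 4 + 1 / 12)))
      + t * Real.BohrMollerup.logGammaSeq t N
      + t ^ 2 / 2 * (harmonic N - Real.log N)
      - t * (Real.log N.factorial - (N * Real.log N - N + Real.log N / 2))
      + ((((N : ℝ) + (1 + t)) ^ 2 / 2 - (N + (1 + t)) / 2 + 1 / 12) * Real.log (1 + (1 + t) / N)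
        - (N + (1 + t)) ^ 2 / 4 + 1 / 12 + (N : ℝ) ^ 2 / 4)
      - ((((N : ℝ) + 1) ^ 2 / 2 - (N + 1) / 2 + 1 / 12) * Real.log (1 + 1 / N)
        - (N + 1) ^ 2 / 4 + 1 / 12 + (N : ℝ) ^ 2 / 4) := by
  have hN' : (0 : ℝ) < N := by positivity
  have hlog : ∀ a : ℝ, 0 < a → Real.log (1 + a / N) = Real.log (N + a) - Real.log N := by
    intro a ha
    rw [← Real.log_div (by positivity) hN'.ne']
    congr 1
    field_simp
  rw [sum_range_barnesG_term ht, hlog _ one_pos, hlog _ (by positivity : (0 : ℝ) < 1 + t),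
    Real.BohrMollerup.logGammaSeq]
  push_cast
  rw [show (N : ℝ) + 1 + t = N + (1 + t) by ring]
  ring

/-- Let `H y` be the meromorphic continuation of the Hurwitz zeta
function `s ↦ ζ(s, y)` for each `y > 0` (differentiable away from `s = 1` and agreeing
with the Dirichlet series `∑ₙ (n + y)⁻ˢ` for `Re s > 1`). Then for all `t > 0`,
`log G(1+t) - t log Γ(t) = ζ'(-1) - ζ'(-1, t)`, where `ζ'(-1)` is the derivative of the
Riemann zeta function at `-1`. -/
theorem logBarnesG_eq_riemannZeta_deriv_sub_hurwitzZeta_deriv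
    (H : ℝ → ℂ → ℂ)
    (Hdiff : ∀ y : ℝ, 0 < y → ∀ s : ℂ, s ≠ 1 → DifferentiableAt ℂ (H y) s)
    (Hser : ∀ y : ℝ, 0 < y → ∀ s : ℂ, 1 < s.re →
      H y s = ∑' n : ℕ, ((n : ℂ) + (y : ℂ)) ^ (-s))
    (t : ℝ) (ht : 0 < t) :
    ((logBarnesG1p t - t * Real.log (Real.Gamma t) : ℝ) : ℂ)
      = deriv riemannZeta (-1) - deriv (H t) (-1) := by
  have hH := (tendsto_deriv_neg_one_of_hurwitz_continuation ht (Hdiff t ht)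
    (Hser t ht)).comp (tendsto_add_atTop_nat 1)
  have hζ := tendsto_deriv_neg_one_of_hurwitz_continuation one_pos
    (fun s hs => differentiableAt_riemannZeta hs) (fun s hs => by
      simp [zeta_eq_tsum_one_div_nat_add_one_cpow hs, Complex.cpow_neg])
  have hD := hζ.sub hH
  set D := deriv riemannZeta (-1) - deriv (H t) (-1)
  simp only [Function.comp_apply, ← Complex.ofReal_sub] at hD
  have hDre := (Complex.continuous_re.tendsto D).comp hD
  simp only [Function.comp_def, Complex.ofReal_re] at hDre
  have hDreal : ((D.re : ℝ) : ℂ) = D :=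
    tendsto_nhds_unique ((Complex.continuous_ofReal.tendsto D.re).comp hDre) hD
  have hlim := ((((hDre.add ((Real.BohrMollerup.tendsto_log_gamma ht).const_mul t)).add
    (Real.tendsto_harmonic_sub_log.const_mul (t ^ 2 / 2))).sub
    (tendsto_log_factorial_sub.const_mul t)).add (tendsto_shifted_eulerMaclaurin (1 + t))).sub
    (tendsto_shifted_eulerMaclaurin 1)
  have hsum := (hasSum_iff_tendsto_nat_of_nonneg (barnesG_term_nonneg ht.le) _).2
    (hlim.congr' (by
      filter_upwards [eventually_ne_atTop 0] with N hN
      exact (sum_range_barnesG_term_eq ht hN).symm))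
  rw [← hDreal, Complex.ofReal_inj, logBarnesG1p, hsum.tsum_eq]
  ring
end

section
/- The first Stieltjes constant satisfies γ₁ = ζ''(0) + (γ + log(2π)) log(2π) − (1/2)[(γ + log(2π))² − (1/2)ζ(2)], where ζ''(0) is the second derivative of the Riemann zeta function at 0; equivalently, ζ''(0) = γ₁ + (1/2)γ² − π²/24 − (1/2) log²(2π). -/
open Real Complex Filter Topology

/-- The entire function `(s - 1) ζ(s)`, with the value `1` filled in at `s = 1`. -/
noncomputable def subOneMulZeta : ℂ → ℂ :=
  Function.update (fun s : ℂ => (s - 1) * riemannZeta s) 1 1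

lemma subOneMulZeta_one : subOneMulZeta 1 = 1 := by
  simp [subOneMulZeta]

lemma subOneMulZeta_of_ne {s : ℂ} (hs : s ≠ 1) :
    subOneMulZeta s = (s - 1) * riemannZeta s := by
  simp [subOneMulZeta, hs]

lemma hasDerivAt_subOneMulZeta_one :
    HasDerivAt subOneMulZeta (Real.eulerMascheroniConstant : ℂ) 1 := by
  rw [hasDerivAt_iff_tendsto_slope]
  refine tendsto_riemannZeta_sub_one_div.congr' ?_
  filter_upwards [self_mem_nhdsWithin] with s hs
  have hs' : s ≠ 1 := hs
  have h : s - 1 ≠ 0 := sub_ne_zero.mpr hs'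
  rw [slope_def_field, subOneMulZeta_one, subOneMulZeta_of_ne hs']
  field_simp

lemma differentiable_subOneMulZeta : Differentiable ℂ subOneMulZeta := by
  intro s
  rcases eq_or_ne s 1 with rfl | hs
  · exact hasDerivAt_subOneMulZeta_one.differentiableAt
  · have h : DifferentiableAt ℂ (fun s : ℂ => (s - 1) * riemannZeta s) s :=
      (differentiableAt_id.sub_const 1).mul (differentiableAt_riemannZeta hs)
    refine h.congr_of_eventuallyEq ?_
    filter_upwards [eventually_ne_nhds hs] with z hz
    exact subOneMulZeta_of_ne hz

lemma iteratedDeriv_two_mul {f g : ℂ → ℂ} {x : ℂ} (hf : AnalyticAt ℂ f x)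
    (hg : AnalyticAt ℂ g x) :
    iteratedDeriv 2 (fun u => f u * g u) x =
      f x * iteratedDeriv 2 g x + 2 * deriv f x * deriv g x + iteratedDeriv 2 f x * g x := by
  rw [iteratedDeriv_fun_mul hf.contDiffAt hg.contDiffAt]
  simp [Finset.sum_range_succ]

lemma iteratedDeriv_three_mul {f g : ℂ → ℂ} {x : ℂ} (hf : AnalyticAt ℂ f x)
    (hg : AnalyticAt ℂ g x) :
    iteratedDeriv 3 (fun u => f u * g u) x =
      f x * iteratedDeriv 3 g x + 3 * deriv f x * iteratedDeriv 2 g x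
        + 3 * iteratedDeriv 2 f x * deriv g x + iteratedDeriv 3 f x * g x := by
  rw [iteratedDeriv_fun_mul hf.contDiffAt hg.contDiffAt]
  simp [Finset.sum_range_succ, Nat.choose]

lemma iteratedDeriv_three_id_mul {f : ℂ → ℂ} (hf : AnalyticAt ℂ f 0) :
    iteratedDeriv 3 (fun u => u * f u) 0 = 3 * iteratedDeriv 2 f 0 := by
  rw [iteratedDeriv_three_mul (f := fun u : ℂ => u) analyticAt_id hf]
  simp [iteratedDeriv_succ]

lemma iteratedDeriv_three_sin_mul (c : ℂ) {f : ℂ → ℂ} (hf : AnalyticAt ℂ f 0) :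
    iteratedDeriv 3 (fun u => Complex.sin (c * u) * f u) 0 =
      3 * c * iteratedDeriv 2 f 0 - c ^ 3 * f 0 := by
  have hs : AnalyticAt ℂ (fun u => Complex.sin (c * u)) 0 := by fun_prop
  have h (n : ℕ) := congrFun (iteratedDeriv_comp_const_mul (n := n) Complex.contDiff_sin c) 0
  have h1 := h 1
  have h2 := h 2
  have h3 := h 3
  simp [iteratedDeriv_succ, iteratedDeriv_zero] at h1 h2 h3
  rw [iteratedDeriv_three_mul hs hf]
  simp only [iteratedDeriv_succ, iteratedDeriv_zero, h1, h2, h3]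
  simp
  ring

lemma analyticAt_Gamma_one : AnalyticAt ℂ Complex.Gamma 1 := by
  rw [Complex.analyticAt_iff_eventually_differentiableAt]
  have hre : ∀ᶠ s : ℂ in 𝓝 1, 0 < s.re :=
    Complex.continuous_re.continuousAt.eventually_const_lt (by simp)
  filter_upwards [hre] with s hs
  refine Complex.differentiableAt_Gamma s fun m hm => ?_
  rw [hm] at hs
  simp at hs
  linarith [(m.cast_nonneg : (0 : ℝ) ≤ m)]

lemma analyticAt_Gamma_one_add : AnalyticAt ℂ (fun u => Complex.Gamma (1 + u)) 0 :=
  AnalyticAt.fun_comp (g := Complex.Gamma) (by simpa using analyticAt_Gamma_one) (by fun_prop)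

lemma analyticAt_Gamma_one_sub : AnalyticAt ℂ (fun u => Complex.Gamma (1 - u)) 0 :=
  AnalyticAt.fun_comp (g := Complex.Gamma) (by simpa using analyticAt_Gamma_one) (by fun_prop)

lemma eventually_sin_mul_Gamma_mul_Gamma :
    (fun u : ℂ => Complex.sin (π * u) * (Complex.Gamma (1 + u) * Complex.Gamma (1 - u)))
      =ᶠ[𝓝 0] fun u => u * (π : ℂ) := by
  have hd : HasDerivAt (fun u : ℂ => Complex.sin (π * u)) (π : ℂ) 0 := by
    simpa using ((hasDerivAt_id (0 : ℂ)).const_mul (π : ℂ)).csin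
  have hne : ∀ᶠ u : ℂ in 𝓝[≠] 0, Complex.sin (π * u) ≠ 0 :=
    hd.eventually_ne (by exact_mod_cast Real.pi_ne_zero)
  filter_upwards [eventually_nhdsWithin_iff.mp hne] with u hu
  rcases eq_or_ne u 0 with rfl | h0
  · simp
  have hs := hu h0
  rw [add_comm, Complex.Gamma_add_one u h0, mul_assoc, Complex.Gamma_mul_Gamma_one_sub]
  field_simp

/-- `Γ''(1) = γ² + π²/6`. -/
lemma iteratedDeriv_two_Gamma_one :
    iteratedDeriv 2 Complex.Gamma 1
      = (Real.eulerMascheroniConstant : ℂ) ^ 2 + (π : ℂ) ^ 2 / 6 := by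
  have hp : (π : ℂ) ≠ 0 := by exact_mod_cast Real.pi_ne_zero
  have h := eventually_sin_mul_Gamma_mul_Gamma.iteratedDeriv_eq 3
  rw [iteratedDeriv_three_sin_mul _ (analyticAt_Gamma_one_add.fun_mul analyticAt_Gamma_one_sub),
    iteratedDeriv_three_id_mul analyticAt_const,
    iteratedDeriv_two_mul analyticAt_Gamma_one_add analyticAt_Gamma_one_sub] at h
  have e1 := congrFun (iteratedDeriv_comp_const_add 2 Complex.Gamma 1) 0
  have e2 := iteratedDeriv_comp_neg 2 (fun u => Complex.Gamma (1 + u)) 0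
  have d1 : deriv (fun u => Complex.Gamma (1 + u)) 0 = -Real.eulerMascheroniConstant := by
    rw [deriv_comp_const_add, add_zero, Complex.hasDerivAt_Gamma_one.deriv]
  have d2 : deriv (fun u => Complex.Gamma (1 - u)) 0 = Real.eulerMascheroniConstant := by
    rw [deriv_comp_const_sub, sub_zero, Complex.hasDerivAt_Gamma_one.deriv, neg_neg]
  simp only [add_zero] at e1
  simp only [← sub_eq_add_neg, neg_zero, e1] at e2
  rw [e1, e2, d1, d2] at h
  simp [iteratedDeriv_const] at h
  apply mul_left_cancel₀ hp
  linear_combination h / 6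

/-- The functional equation of `ζ` around `s = 1`, cleared of its pole. -/
lemma eventually_mul_riemannZeta_neg :
    (fun u : ℂ => u * riemannZeta (-u)) =ᶠ[𝓝 0] fun u => -(1 / (π : ℂ)) *
      (Complex.sin (π / 2 * u) * (Complex.exp (-(Real.log (2 * π) : ℝ) * u) *
        (Complex.Gamma (1 + u) * subOneMulZeta (1 + u)))) := by
  have hp : (π : ℂ) ≠ 0 := by exact_mod_cast Real.pi_ne_zero
  have hre : ∀ᶠ u : ℂ in 𝓝 0, -1 < u.re :=
    Complex.continuous_re.continuousAt.eventually_const_lt (by simp)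
  filter_upwards [hre] with u hu
  rcases eq_or_ne u 0 with rfl | h0
  · simp
  have hn (n : ℕ) : 1 + u ≠ -n := fun h => by
    have := congrArg Complex.re h
    simp at this
    have : (0 : ℝ) ≤ n := n.cast_nonneg
    linarith
  have h1 : 1 + u ≠ 1 := by simpa using h0
  have hz := riemannZeta_one_sub hn h1
  have hcos : Complex.cos (π * (1 + u) / 2) = -Complex.sin (π / 2 * u) := by
    rw [← Complex.cos_add_pi_div_two]
    congr 1
    ring
  have hpow : (2 * (π : ℂ)) ^ (-(1 + u))
      = 1 / (2 * π) * Complex.exp (-(Real.log (2 * π) : ℝ) * u) := by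
    have h2 : (2 * (π : ℂ)) ≠ 0 := mul_ne_zero two_ne_zero hp
    rw [neg_add, Complex.cpow_add _ _ h2, Complex.cpow_neg_one, one_div,
      Complex.cpow_def_of_ne_zero h2, Complex.ofReal_log (by positivity)]
    push_cast
    congr 2
    ring
  rw [show 1 - (1 + u) = -u by ring, hcos, hpow] at hz
  rw [hz, subOneMulZeta_of_ne h1]
  field_simp
  ring

lemma iteratedDeriv_two_riemannZeta_zero :
    iteratedDeriv 2 riemannZeta 0
      = -(1 / 2 : ℂ) * iteratedDeriv 2 subOneMulZeta 1
        + (Real.eulerMascheroniConstant : ℂ) ^ 2 / 2 - (π : ℂ) ^ 2 / 24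
        - ((Real.log (2 * π) : ℝ) : ℂ) ^ 2 / 2 := by
  have hp : (π : ℂ) ≠ 0 := by exact_mod_cast Real.pi_ne_zero
  have hZ : AnalyticAt ℂ (fun u => riemannZeta (-u)) 0 := by
    refine AnalyticAt.fun_comp (g := riemannZeta) ?_ (by fun_prop)
    rw [Complex.analyticAt_iff_eventually_differentiableAt, neg_zero]
    filter_upwards [eventually_ne_nhds zero_ne_one] with s hs
    exact differentiableAt_riemannZeta hs
  have hD : AnalyticAt ℂ (fun u => subOneMulZeta (1 + u)) 0 :=
    AnalyticAt.fun_comp (differentiable_subOneMulZeta.analyticAt _) (by fun_prop)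
  have hG := analyticAt_Gamma_one_add
  set L : ℂ := ((Real.log (2 * π) : ℝ) : ℂ)
  have hE : AnalyticAt ℂ (fun u => Complex.exp (-L * u)) 0 := by fun_prop
  have hE1 : HasDerivAt (fun u => Complex.exp (-L * u)) (-L) 0 := by
    simpa using ((hasDerivAt_id (0 : ℂ)).const_mul (-L)).cexp
  have h := eventually_mul_riemannZeta_neg.iteratedDeriv_eq 3
  rw [iteratedDeriv_three_id_mul hZ, iteratedDeriv_const_mul_field,
    iteratedDeriv_three_sin_mul _ (hE.fun_mul (hG.fun_mul hD)), iteratedDeriv_two_mul hE (hG.fun_mul hD),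
    iteratedDeriv_two_mul hG hD, deriv_fun_mul hG.differentiableAt hD.differentiableAt,
    iteratedDeriv_comp_neg, iteratedDeriv_comp_const_add, iteratedDeriv_comp_const_add,
    deriv_comp_const_add, deriv_comp_const_add, iteratedDeriv_cexp_const_mul,
    hE1.deriv] at h
  simp only [add_zero, Complex.hasDerivAt_Gamma_one.deriv, hasDerivAt_subOneMulZeta_one.deriv,
    iteratedDeriv_two_Gamma_one, subOneMulZeta_one, Complex.Gamma_one, mul_zero,
    Complex.exp_zero, neg_zero] at h
  field_simp at h
  simp at h
  linear_combination h / 144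

/-- The first Stieltjes constant `γ₁` (defined as
`-(1/2) · d²/ds²[(s-1)ζ(s)]` at `s = 1`, where the removable singularity of
`(s-1)ζ(s)` at `s = 1` is filled in with its limiting value `1`) satisfies
`γ₁ = ζ''(0) + (γ + log 2π) log 2π - (1/2)[(γ + log 2π)² - (1/2)ζ(2)]`;
equivalently `ζ''(0) = γ₁ + (1/2)γ² - π²/24 - (1/2) log²(2π)`, with `ζ(2) = π²/6`. -/
theorem stieltjes_gamma1_eq_zeta_second_deriv_zero :
    (-(1 / 2 : ℂ) * iteratedDeriv 2
          (Function.update (fun s : ℂ => (s - 1) * riemannZeta s) 1 1) 1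
        = iteratedDeriv 2 riemannZeta 0
          + ((Real.eulerMascheroniConstant + Real.log (2 * π)) * Real.log (2 * π) : ℝ)
          - (1 / 2 : ℂ) * (((Real.eulerMascheroniConstant + Real.log (2 * π)) ^ 2
              - (1 / 2) * (π ^ 2 / 6) : ℝ) : ℂ))
    ∧ iteratedDeriv 2 riemannZeta 0
        = -(1 / 2 : ℂ) * iteratedDeriv 2
            (Function.update (fun s : ℂ => (s - 1) * riemannZeta s) 1 1) 1
          + ((1 / 2) * Real.eulerMascheroniConstant ^ 2 - π ^ 2 / 24
              - (1 / 2) * Real.log (2 * π) ^ 2 : ℝ) := by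
  have h := iteratedDeriv_two_riemannZeta_zero
  rw [subOneMulZeta] at h
  constructor
  · rw [h]
    push_cast
    ring
  · rw [h]
    push_cast
    ring
end
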